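/- Suppose each C_i satisfies the (ε,δ)-lower deviation inequality, where ε + δ < 1. Then for any R > 0, the mean-weighted allocation v = (R·μ_1/Z, …, R·μ_K/Z) has utilization U(v) ≥ (1−ε−δ)·min(R, Z). -/

import Mathlib

open MeasureTheory ProbabilityTheory

/-- A truncated mean `E[min(X, v)]` is bounded below by `s * (1 - δ)` as soon as `s ≤ v` and `X`
exceeds a level `t ≥ s` with probability at least `1 - δ`. -/
theorem mul_one_sub_le_integral_min {Ω : Type*} [MeasurableSpace Ω] {P : Measure Ω}
    [IsProbabilityMeasure P] {X : Ω → ℝ} (hX : Measurable X) (hXint : Integrable X P)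
    (hX0 : ∀ ω, 0 ≤ X ω) {s t v δ : ℝ} (hs : 0 ≤ s) (hst : s ≤ t) (hsv : s ≤ v)
    (hδ : (P {ω | X ω ≤ t}).toReal ≤ δ) :
    s * (1 - δ) ≤ ∫ ω, min (X ω) v ∂P := by
  have hS : MeasurableSet {ω | X ω ≤ t} := measurableSet_le hX measurable_const
  have hc : P.real {ω | X ω ≤ t}ᶜ = 1 - P.real {ω | X ω ≤ t} := probReal_compl_eq_one_sub hS
  have hδ' : P.real {ω | X ω ≤ t} ≤ δ := hδ
  calc s * (1 - δ) ≤ s * P.real {ω | X ω ≤ t}ᶜ :=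
        mul_le_mul_of_nonneg_left (by linarith) hs
    _ = ∫ ω, {ω | X ω ≤ t}ᶜ.indicator (fun _ => s) ω ∂P := by
        rw [integral_indicator_const s hS.compl, smul_eq_mul, mul_comm]
    _ ≤ ∫ ω, min (X ω) v ∂P := by
        refine integral_mono ((integrable_const s).indicator hS.compl)
          (hXint.inf (integrable_const v)) fun ω => ?_
        by_cases h : X ω ≤ t
        · simpa [Set.indicator, h] using ⟨hX0 ω, hs.trans hsv⟩
        · simpa [Set.indicator, h] using ⟨hst.trans (not_le.mp h).le, hsv⟩

/-- If each `C i` satisfies the `(ε,δ)`-lower deviation inequality with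
`ε + δ < 1`, then for any `R > 0` the mean-weighted allocation has utilization
`U(v) ≥ (1-ε-δ) * min R Z`. -/
theorem meanWeighted_utilization
    {Ω : Type*} [MeasureSpace Ω] [IsProbabilityMeasure (ℙ : Measure Ω)]
    {K : ℕ} (hK : 0 < K)
    (C : Fin K → Ω → ℝ)
    (hmeas : ∀ i, Measurable (C i))
    (hint : ∀ i, Integrable (C i))
    (hnonneg : ∀ i, ∀ ω, 0 ≤ C i ω)
    (μ : Fin K → ℝ) (hμ : ∀ i, μ i = ∫ ω, C i ω) (hμpos : ∀ i, 0 < μ i)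
    (ε δ : ℝ) (hε0 : 0 < ε) (hε1 : ε < 1) (hδ0 : 0 < δ) (hδ1 : δ < 1)
    (hεδ : ε + δ < 1)
    (hLD : ∀ i, (ℙ {ω | C i ω ≤ (1 - ε) * μ i}).toReal ≤ δ)
    (R : ℝ) (hR : 0 < R)
    (Z : ℝ) (hZ : Z = ∑ i, μ i)
    (v : Fin K → ℝ) (hv : ∀ i, v i = R * μ i / Z) :
    (1 - ε - δ) * min R Z ≤ ∑ i, ∫ ω, min (C i ω) (v i) := by
  have hZpos : 0 < Z := by
    rw [hZ]
    exact Finset.sum_pos (fun i _ => hμpos i) ⟨⟨0, hK⟩, Finset.mem_univ _⟩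
  have hm : 0 < min R Z := lt_min hR hZpos
  have hsum : ∑ i, μ i * min R Z / Z = min R Z := by
    rw [← Finset.sum_div, ← Finset.sum_mul, ← hZ]
    field_simp
  rw [← hsum, Finset.mul_sum]
  refine Finset.sum_le_sum fun i _ => ?_
  have ha : 0 < μ i * min R Z / Z := div_pos (mul_pos (hμpos i) hm) hZpos
  have haμ : μ i * min R Z / Z ≤ μ i := by
    rw [div_le_iff₀ hZpos]
    exact mul_le_mul_of_nonneg_left (min_le_right R Z) (hμpos i).le
  have hav : μ i * min R Z / Z ≤ v i := by
    rw [hv i, mul_comm R]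
    exact div_le_div_of_nonneg_right
      (mul_le_mul_of_nonneg_left (min_le_left R Z) (hμpos i).le) hZpos.le
  have h1ε : 0 < 1 - ε := sub_pos.mpr hε1
  have key := mul_one_sub_le_integral_min (hmeas i) (hint i) (hnonneg i)
    (s := (1 - ε) * (μ i * min R Z / Z)) (v := v i) (mul_pos h1ε ha).le
    (mul_le_mul_of_nonneg_left haμ h1ε.le)
    ((mul_le_of_le_one_left ha.le (by linarith)).trans hav) (hLD i)
  refine le_trans ?_ key
  nlinarith [mul_pos (mul_pos hε0 hδ0) ha]
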